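/- If three non-horizontal lines in ℝ³ are pairwise skew and all parallel to a common plane, and three kinetic points move along them, then for any fixed pair of the lines, the union over t ∈ ℝ of the horizontal lines through the corresponding two moving points is the zero set of an irreducible quadratic polynomial in (x, y, z) whose quadratic part has signature corresponding to a hyperbolic paraboloid (determinant of the full 4×4 matrix nonzero, 3×3 quadratic-part matrix singular). -/

import Mathlib

open Matrix

open MvPolynomial in
/-- A polynomial of total degree at most one evaluates to an affine function. -/
theorem MvPolynomial.exists_eval_eq_affine {σ R : Type*} [Fintype σ] [CommSemiring R]
    (p : MvPolynomial σ R) (hp : p.totalDegree ≤ 1) :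
    ∃ (c : R) (g : σ → R), ∀ x : σ → R, eval x p = c + ∑ i, g i * x i := by
  classical
  refine ⟨p.coeff 0, fun i => p.coeff (Finsupp.single i 1), fun x => ?_⟩
  have hsub : p.support ⊆
      insert 0 (Finset.univ.image fun i : σ => Finsupp.single i 1) := by
    intro m hm
    have h1 : m.degree ≤ 1 := (le_totalDegree hm).trans hp
    rcases Nat.le_one_iff_eq_zero_or_eq_one.mp h1 with h | h
    · simp [(Finsupp.degree_eq_zero_iff m).mp h]
    · obtain ⟨i, rfl⟩ := Finsupp.range_single_one.superset h
      simp
  rw [eval_eq, Finset.sum_subset hsub, Finset.sum_insert, Finset.sum_image]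
  · simp [Finsupp.single_apply]
  · intro i _ j _ h
    exact (Finsupp.single_left_inj one_ne_zero).mp h
  · simp
  · intro m _ hm
    simp [notMem_support_iff.mp hm]

/-- A product of two affine functions of three variables that has no terms in `x²`, `xy`, `y²`
has proportional `(x, y)`-coefficients in degree one and two. -/
theorem affine_mul_affine_det_eq_zero {K : Type*} [Field K] [CharZero K] {c e : K} {g h : Fin 3 → K}
    {p₁ p₂ d₁ d₂ k l m : K}
    (H : ∀ x : Fin 3 → K, (c + ∑ i, g i * x i) * (e + ∑ i, h i * x i) =
      (p₁ + x 2 * d₁) * x 1 - (p₂ + x 2 * d₂) * x 0 + (k + l * x 2 + m * x 2 ^ 2)) :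
    d₁ * p₂ - d₂ * p₁ = 0 := by
  simp only [Fin.sum_univ_three] at H
  have e0 := H ![0, 0, 0]
  have ex := H ![1, 0, 0]
  have ex' := H ![-1, 0, 0]
  have ey := H ![0, 1, 0]
  have ey' := H ![0, -1, 0]
  have ez := H ![0, 0, 1]
  have exy := H ![1, 1, 0]
  have exz := H ![1, 0, 1]
  have eyz := H ![0, 1, 1]
  simp at e0 ex ex' ey ey' ez exy exz eyz
  have h00 : g 0 * h 0 = 0 := by linear_combination (ex + ex' - 2 * e0) / 2
  have h11 : g 1 * h 1 = 0 := by linear_combination (ey + ey' - 2 * e0) / 2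
  have h01 : g 0 * h 1 + g 1 * h 0 = 0 := by linear_combination exy - ex - ey + e0
  have h0 : c * h 0 + g 0 * e = -p₂ := by linear_combination (ex - ex') / 2
  have h1 : c * h 1 + g 1 * e = p₁ := by linear_combination (ey - ey') / 2
  have h02 : g 0 * h 2 + g 2 * h 0 = -d₂ := by linear_combination exz - ex - ez + e0
  have h12 : g 1 * h 2 + g 2 * h 1 = d₁ := by linear_combination eyz - ey - ez + e0
  have key : (g 0 = 0 ∧ g 1 = 0) ∨ (h 0 = 0 ∧ h 1 = 0) := by
    by_cases hg0 : g 0 = 0 <;> by_cases hg1 : g 1 = 0 <;> simp_all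
  have hp₂ : p₂ = -(c * h 0 + g 0 * e) := by rw [h0, neg_neg]
  have hd₂ : d₂ = -(g 0 * h 2 + g 2 * h 0) := by rw [h02, neg_neg]
  rw [← h12, ← h1, hp₂, hd₂]
  rcases key with ⟨h, h'⟩ | ⟨h, h'⟩ <;> rw [h, h'] <;> ring

/-- A relatively moving pair of points in the plane that never meet has nonzero
cross product of relative velocity and relative position. -/
theorem cross_ne_zero_of_forall_ne {a b u v : ℝ × ℝ} (huv : u ≠ v)
    (h : ∀ t : ℝ, a + t • u ≠ b + t • v) :
    (v.1 - u.1) * (b.2 - a.2) - (v.2 - u.2) * (b.1 - a.1) ≠ 0 := by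
  intro h0
  have hd : (v.1 - u.1) ^ 2 + (v.2 - u.2) ^ 2 ≠ 0 := by
    intro h1
    apply huv
    ext <;> nlinarith [sq_nonneg (v.1 - u.1), sq_nonneg (v.2 - u.2)]
  apply h (-((v.1 - u.1) * (b.1 - a.1) + (v.2 - u.2) * (b.2 - a.2)) /
    ((v.1 - u.1) ^ 2 + (v.2 - u.2) ^ 2))
  ext
  · simp only [Prod.fst_add, Prod.smul_fst, smul_eq_mul]
    field_simp
    linear_combination (v.2 - u.2) * h0
  · simp only [Prod.snd_add, Prod.smul_snd, smul_eq_mul]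
    field_simp
    linear_combination -(v.1 - u.1) * h0

/-- The quadratic polynomial `(p + z d) × ((x, y) - a - z u)` vanishing on the union of the
horizontal lines through `a + z u` and `a + p + z (u + d)`. -/
noncomputable def ruledQuadric (a u p d : ℝ × ℝ) : MvPolynomial (Fin 3) ℝ :=
  (.C p.1 + .X 2 * .C d.1) * (.X 1 - .C a.2 - .X 2 * .C u.2) -
    (.C p.2 + .X 2 * .C d.2) * (.X 0 - .C a.1 - .X 2 * .C u.1)

namespace ruledQuadric

variable (a u p d : ℝ × ℝ)

theorem eval_eq (x : Fin 3 → ℝ) :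
    MvPolynomial.eval x (ruledQuadric a u p d) =
      (p.1 + x 2 * d.1) * (x 1 - a.2 - x 2 * u.2) -
        (p.2 + x 2 * d.2) * (x 0 - a.1 - x 2 * u.1) := by
  simp [ruledQuadric]

theorem totalDegree_le : (ruledQuadric a u p d).totalDegree ≤ 2 := by
  have hXC (r : ℝ) : (MvPolynomial.X 2 * MvPolynomial.C r :
      MvPolynomial (Fin 3) ℝ).totalDegree ≤ 1 :=
    (MvPolynomial.totalDegree_mul _ _).trans (by simp)
  have h₁ (r s : ℝ) : (MvPolynomial.C r + MvPolynomial.X 2 * MvPolynomial.C s :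
      MvPolynomial (Fin 3) ℝ).totalDegree ≤ 1 :=
    (MvPolynomial.totalDegree_add _ _).trans (max_le (by simp) (hXC s))
  have h₂ (i : Fin 3) (r s : ℝ) : (MvPolynomial.X i - MvPolynomial.C r -
      MvPolynomial.X 2 * MvPolynomial.C s : MvPolynomial (Fin 3) ℝ).totalDegree ≤ 1 :=
    (MvPolynomial.totalDegree_sub _ _).trans
      (max_le ((MvPolynomial.totalDegree_sub _ _).trans (by simp)) (hXC s))
  exact (MvPolynomial.totalDegree_sub _ _).trans (max_le
    ((MvPolynomial.totalDegree_mul _ _).trans (add_le_add (h₁ _ _) (h₂ _ _ _)))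
    ((MvPolynomial.totalDegree_mul _ _).trans (add_le_add (h₁ _ _) (h₂ _ _ _))))

variable {a u p d}

theorem ne_mul (h : d.1 * p.2 - d.2 * p.1 ≠ 0) {G H : MvPolynomial (Fin 3) ℝ}
    (hG : G.totalDegree ≤ 1) (hH : H.totalDegree ≤ 1) : ruledQuadric a u p d ≠ G * H := by
  intro hF
  obtain ⟨c, g, hg⟩ := G.exists_eval_eq_affine hG
  obtain ⟨e, k, hk⟩ := H.exists_eval_eq_affine hH
  refine h (affine_mul_affine_det_eq_zero (c := c) (e := e) (g := g) (h := k)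
    (k := p.2 * a.1 - p.1 * a.2)
    (l := p.2 * u.1 + d.2 * a.1 - p.1 * u.2 - d.1 * a.2)
    (m := d.2 * u.1 - d.1 * u.2) fun x => ?_)
  rw [← hg, ← hk, ← map_mul, ← hF, eval_eq]
  ring

theorem totalDegree_eq (h : d.1 * p.2 - d.2 * p.1 ≠ 0) :
    (ruledQuadric a u p d).totalDegree = 2 := by
  refine le_antisymm (totalDegree_le a u p d) ?_
  by_contra! hlt
  exact ne_mul (a := a) (u := u) h (Nat.lt_succ_iff.mp hlt) (H := 1) (by simp) (mul_one _).symm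

theorem irreducible (h : d.1 * p.2 - d.2 * p.1 ≠ 0) : Irreducible (ruledQuadric a u p d) := by
  have hdeg := totalDegree_eq (a := a) (u := u) h
  have isUnit_of {G : MvPolynomial (Fin 3) ℝ} (hG : G ≠ 0) (hG0 : G.totalDegree = 0) :
      IsUnit G := by
    rw [MvPolynomial.totalDegree_eq_zero_iff_eq_C.mp hG0] at hG ⊢
    exact (isUnit_iff_ne_zero.mpr fun h0 => hG (by rw [h0, map_zero])).map MvPolynomial.C
  refine ⟨fun hu => ?_, fun G H hF => ?_⟩
  · rw [MvPolynomial.isUnit_iff_totalDegree_of_isReduced] at hu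
    omega
  · have hF0 : ruledQuadric a u p d ≠ 0 := by
      intro h0
      simp [h0] at hdeg
    have hG : G ≠ 0 := by rintro rfl; simp_all
    have hH : H ≠ 0 := by rintro rfl; simp_all
    rw [hF, MvPolynomial.totalDegree_mul_of_isDomain hG hH] at hdeg
    by_cases hG0 : G.totalDegree = 0
    · exact .inl (isUnit_of hG hG0)
    by_cases hH0 : H.totalDegree = 0
    · exact .inr (isUnit_of hH hH0)
    exact absurd hF (ne_mul h (by omega) (by omega))

variable (a u p d)

/-- The symmetric matrix of the quadric `ruledQuadric a u p d`. -/
noncomputable def matrix : Matrix (Fin 4) (Fin 4) ℝ :=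
  !![0, 0, -d.2 / 2, -p.2 / 2;
     0, 0, d.1 / 2, p.1 / 2;
     -d.2 / 2, d.1 / 2, d.2 * u.1 - d.1 * u.2,
       (p.2 * u.1 + d.2 * a.1 - p.1 * u.2 - d.1 * a.2) / 2;
     -p.2 / 2, p.1 / 2, (p.2 * u.1 + d.2 * a.1 - p.1 * u.2 - d.1 * a.2) / 2,
       p.2 * a.1 - p.1 * a.2]

theorem isSymm_matrix : (matrix a u p d).IsSymm := by
  ext i j
  fin_cases i <;> fin_cases j <;> rfl

theorem eval_eq_dotProduct_matrix (x : Fin 3 → ℝ) :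
    MvPolynomial.eval x (ruledQuadric a u p d) =
      ![x 0, x 1, x 2, 1] ⬝ᵥ (matrix a u p d).mulVec ![x 0, x 1, x 2, 1] := by
  rw [eval_eq]
  simp [matrix, Matrix.mulVec, dotProduct, Fin.sum_univ_four]
  ring

theorem det_matrix : (matrix a u p d).det = ((d.1 * p.2 - d.2 * p.1) / 4) ^ 2 := by
  simp [matrix, Matrix.det_succ_row_zero, Fin.sum_univ_succ, Fin.succAbove]
  ring

theorem submatrix_matrix : (matrix a u p d).submatrix Fin.castSucc Fin.castSucc =
    !![0, 0, -d.2 / 2; 0, 0, d.1 / 2; -d.2 / 2, d.1 / 2, d.2 * u.1 - d.1 * u.2] := by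
  ext i j
  fin_cases i <;> fin_cases j <;> rfl

theorem det_submatrix_matrix :
    ((matrix a u p d).submatrix Fin.castSucc Fin.castSucc).det = 0 := by
  rw [submatrix_matrix, Matrix.det_fin_three]
  simp

variable {d}

theorem rank_submatrix_matrix (hd : d.1 ^ 2 + d.2 ^ 2 ≠ 0) :
    ((matrix a u p d).submatrix Fin.castSucc Fin.castSucc).rank = 2 := by
  rw [submatrix_matrix]
  set M : Matrix (Fin 3) (Fin 3) ℝ :=
    !![0, 0, -d.2 / 2; 0, 0, d.1 / 2; -d.2 / 2, d.1 / 2, d.2 * u.1 - d.1 * u.2] with hM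
  apply le_antisymm
  · have hfac : M = !![-d.2 / 2, 0; d.1 / 2, 0; (d.2 * u.1 - d.1 * u.2) / 2, 1] *
        !![0, 0, 1; -d.2 / 2, d.1 / 2, (d.2 * u.1 - d.1 * u.2) / 2] := by
      ext i j
      fin_cases i <;> fin_cases j <;> simp [hM, Matrix.mul_apply]
    rw [hfac]
    exact (Matrix.rank_mul_le_left _ _).trans (Matrix.rank_le_width _)
  · have hdet : (!![-d.2, d.1, 0; 0, 0, 1] * M * !![-d.2, 0; d.1, 0; 0, 1]).det ≠ 0 := by
      have : (!![-d.2, d.1, 0; 0, 0, 1] * M * !![-d.2, 0; d.1, 0; 0, 1]).det =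
          -((d.1 ^ 2 + d.2 ^ 2) / 2) ^ 2 := by
        simp [hM, Matrix.det_fin_two]
        ring
      rw [this]
      exact neg_ne_zero.mpr (pow_ne_zero 2 (div_ne_zero hd two_ne_zero))
    have hrank := Matrix.rank_of_isUnit _
      ((Matrix.isUnit_iff_isUnit_det _).mpr (isUnit_iff_ne_zero.mpr hdet))
    rw [Fintype.card_fin] at hrank
    exact hrank.symm.le.trans
      ((Matrix.rank_mul_le_left _ _).trans (Matrix.rank_mul_le_right _ _))

theorem exists_dotProduct_submatrix_eq (hd : d.1 ^ 2 + d.2 ^ 2 ≠ 0) (r : ℝ) :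
    ∃ y : Fin 3 → ℝ,
      y ⬝ᵥ ((matrix a u p d).submatrix Fin.castSucc Fin.castSucc).mulVec y = r := by
  refine ⟨![-d.2 * ((r - (d.2 * u.1 - d.1 * u.2)) / (d.1 ^ 2 + d.2 ^ 2)),
    d.1 * ((r - (d.2 * u.1 - d.1 * u.2)) / (d.1 ^ 2 + d.2 ^ 2)), 1], ?_⟩
  rw [submatrix_matrix]
  simp [Matrix.mulVec, dotProduct, Fin.sum_univ_three]
  field_simp
  ring

theorem eval_eq_zero_iff {a b u v : ℝ × ℝ}
    (h : ∀ t : ℝ, a + t • u ≠ b + t • v) (x : Fin 3 → ℝ) :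
    MvPolynomial.eval x (ruledQuadric a u (b - a) (v - u)) = 0 ↔
      ∃ s t : ℝ, x 0 = ((1 - s) • (a + t • u) + s • (b + t • v)).1 ∧
        x 1 = ((1 - s) • (a + t • u) + s • (b + t • v)).2 ∧ x 2 = t := by
  rw [eval_eq]
  simp only [Prod.fst_add, Prod.snd_add, Prod.smul_fst, Prod.smul_snd, smul_eq_mul,
    Prod.fst_sub, Prod.snd_sub]
  constructor
  · intro h0
    by_cases h1 : b.1 - a.1 + x 2 * (v.1 - u.1) = 0
    · have h2 : b.2 - a.2 + x 2 * (v.2 - u.2) ≠ 0 := by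
        intro h2
        refine h (x 2) (Prod.ext ?_ ?_) <;> simp <;> linarith
      refine ⟨(x 1 - a.2 - x 2 * u.2) / (b.2 - a.2 + x 2 * (v.2 - u.2)), x 2, ?_, ?_, rfl⟩
      · have h3 : x 0 - a.1 - x 2 * u.1 = 0 := by
          rw [h1, zero_mul, zero_sub, neg_eq_zero] at h0
          exact (mul_eq_zero.mp h0).resolve_left h2
        linear_combination h3 -
          (x 1 - a.2 - x 2 * u.2) / (b.2 - a.2 + x 2 * (v.2 - u.2)) * h1
      · linear_combination -(div_mul_cancel₀ (x 1 - a.2 - x 2 * u.2) h2)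
    · refine ⟨(x 0 - a.1 - x 2 * u.1) / (b.1 - a.1 + x 2 * (v.1 - u.1)), x 2, ?_, ?_, rfl⟩
      · linear_combination -(div_mul_cancel₀ (x 0 - a.1 - x 2 * u.1) h1)
      · apply mul_left_cancel₀ h1
        linear_combination h0 - (b.2 - a.2 + x 2 * (v.2 - u.2)) *
          div_mul_cancel₀ (x 0 - a.1 - x 2 * u.1) h1
  · rintro ⟨s, t, h0, h1, rfl⟩
    rw [h0, h1]
    ring

end ruledQuadric

/-- If three kinetic points have pairwise skew trajectory lines in `ℝ³` (non-horizontal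
since they are trajectories) all parallel to a common plane, then for the pair `a, b`
the union over `t` of the horizontal lines through `(a(t), t)` and `(b(t), t)` is the
zero set of an irreducible quadratic polynomial `F(x, y, z)` whose associated symmetric
4×4 matrix is nonsingular while the 3×3 matrix of its quadratic part is singular of
rank 2 and indefinite — i.e. the quadric is a hyperbolic paraboloid. -/
theorem skew_lines_rule_hyperbolic_paraboloid
    (a₀ b₀ c₀ u v w : ℝ × ℝ)
    (hab : u ≠ v ∧ ∀ t : ℝ, a₀ + t • u ≠ b₀ + t • v)
    (hac : u ≠ w ∧ ∀ t : ℝ, a₀ + t • u ≠ c₀ + t • w)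
    (hbc : v ≠ w ∧ ∀ t : ℝ, b₀ + t • v ≠ c₀ + t • w)
    (hplane : ∃ W : Submodule ℝ ((ℝ × ℝ) × ℝ), Module.finrank ℝ W = 2 ∧
      ((u, 1) : (ℝ × ℝ) × ℝ) ∈ W ∧ ((v, 1) : (ℝ × ℝ) × ℝ) ∈ W ∧
      ((w, 1) : (ℝ × ℝ) × ℝ) ∈ W) :
    ∃ F : MvPolynomial (Fin 3) ℝ,
      F.totalDegree = 2 ∧ Irreducible F ∧
      {x : Fin 3 → ℝ | MvPolynomial.eval x F = 0} =
        {x : Fin 3 → ℝ | ∃ s t : ℝ,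
          x 0 = ((1 - s) • (a₀ + t • u) + s • (b₀ + t • v)).1 ∧
          x 1 = ((1 - s) • (a₀ + t • u) + s • (b₀ + t • v)).2 ∧
          x 2 = t} ∧
      ∃ A : Matrix (Fin 4) (Fin 4) ℝ, A.IsSymm ∧
        (∀ x : Fin 3 → ℝ,
          MvPolynomial.eval x F =
            ![x 0, x 1, x 2, 1] ⬝ᵥ A.mulVec ![x 0, x 1, x 2, 1]) ∧
        A.det ≠ 0 ∧
        (A.submatrix Fin.castSucc Fin.castSucc).det = 0 ∧
        (A.submatrix Fin.castSucc Fin.castSucc).rank = 2 ∧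
        (∃ y z : Fin 3 → ℝ,
          0 < y ⬝ᵥ (A.submatrix Fin.castSucc Fin.castSucc).mulVec y ∧
          z ⬝ᵥ (A.submatrix Fin.castSucc Fin.castSucc).mulVec z < 0) := by
  have hcross := cross_ne_zero_of_forall_ne hab.1 hab.2
  have hd : (v - u).1 ^ 2 + (v - u).2 ^ 2 ≠ 0 := by
    intro h0
    have h1 : v.1 - u.1 = 0 := by
      rw [Prod.fst_sub, Prod.snd_sub] at h0
      nlinarith [sq_nonneg (v.1 - u.1), sq_nonneg (v.2 - u.2)]
    have h2 : v.2 - u.2 = 0 := by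
      rw [Prod.fst_sub, Prod.snd_sub] at h0
      nlinarith [sq_nonneg (v.1 - u.1), sq_nonneg (v.2 - u.2)]
    exact hcross (by rw [h1, h2]; ring)
  refine ⟨ruledQuadric a₀ u (b₀ - a₀) (v - u), ruledQuadric.totalDegree_eq hcross,
    ruledQuadric.irreducible hcross, Set.ext (ruledQuadric.eval_eq_zero_iff hab.2),
    ruledQuadric.matrix a₀ u (b₀ - a₀) (v - u), ruledQuadric.isSymm_matrix _ _ _ _,
    ruledQuadric.eval_eq_dotProduct_matrix _ _ _ _, ?_,
    ruledQuadric.det_submatrix_matrix _ _ _ _, ruledQuadric.rank_submatrix_matrix _ _ _ hd, ?_⟩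
  · rw [ruledQuadric.det_matrix]
    exact pow_ne_zero 2 (div_ne_zero hcross four_ne_zero)
  · obtain ⟨y, hy⟩ := ruledQuadric.exists_dotProduct_submatrix_eq a₀ u (b₀ - a₀) hd 1
    obtain ⟨z, hz⟩ := ruledQuadric.exists_dotProduct_submatrix_eq a₀ u (b₀ - a₀) hd (-1)
    exact ⟨y, z, by rw [hy]; exact one_pos, by rw [hz]; norm_num⟩
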